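/- arXiv:1710.04621 — 2 statements merged into one kernel-verified Lean document; each statement's English description precedes it below -/
import Mathlib

section
/- For m = 1, the derivative of the averaged sampling series satisfies (S̄_w f)'(t) = (K_w f')(t − 1/(2w)) for all t ∈ ℝ, whenever f ∈ AC(ℝ). -/
open MeasureTheory

noncomputable def avgKernel (χ : ℝ → ℝ) (m : ℕ) (t : ℝ) : ℝ :=
  (1 / (m : ℝ)) * ∫ v in (-((m : ℝ) / 2))..((m : ℝ) / 2), χ (t + v)

noncomputable def avgSamplingSeries (χ f : ℝ → ℝ) (m : ℕ) (w t : ℝ) : ℝ :=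
  ∑' k : ℤ, f ((k : ℝ) / w) * avgKernel χ m (w * t - (k : ℝ))

noncomputable def kantorovich (χ g : ℝ → ℝ) (w t : ℝ) : ℝ :=
  ∑' k : ℤ, (w * ∫ u in ((k : ℝ) / w)..(((k : ℝ) + 1) / w), g u) * χ (w * t - (k : ℝ))

def ACOn (f : ℝ → ℝ) (a b : ℝ) : Prop :=
  ∀ ε > (0 : ℝ), ∃ δ > (0 : ℝ), ∀ (n : ℕ) (s t : ℕ → ℝ),
    (∀ i < n, a ≤ s i ∧ s i ≤ t i ∧ t i ≤ b) →
    (Set.PairwiseDisjoint (↑(Finset.range n)) fun i => Set.Ioo (s i) (t i)) →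
    (∑ i ∈ Finset.range n, (t i - s i)) < δ →
    (∑ i ∈ Finset.range n, |f (t i) - f (s i)|) < ε

def ACloc (f : ℝ → ℝ) : Prop := ∀ a b : ℝ, ACOn f a b

theorem ACOn.absolutelyContinuousOnInterval {f : ℝ → ℝ} {a b : ℝ} (hab : a ≤ b)
    (hf : ACOn f a b) : AbsolutelyContinuousOnInterval f a b := by
  rw [absolutelyContinuousOnInterval_iff]
  intro ε hε
  obtain ⟨δ, hδ, H⟩ := hf ε hε
  refine ⟨δ, hδ, fun E hE hlen => ?_⟩
  obtain ⟨hmem, hdisj⟩ := hE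
  have key := H E.1 (fun i => min (E.2 i).1 (E.2 i).2) (fun i => max (E.2 i).1 (E.2 i).2)
    (fun i hi => ?_) (hdisj.mono fun i => ?_) ?_
  · refine (Finset.sum_congr rfl fun i _ => ?_).trans_lt key
    rcases le_total (E.2 i).1 (E.2 i).2 with h | h
    · simp [h, Real.dist_eq, abs_sub_comm]
    · simp [h, Real.dist_eq]
  · have := hmem i (Finset.mem_range.2 hi)
    rw [Set.uIcc_of_le hab] at this
    exact ⟨le_min this.1.1 this.2.1, min_le_max, max_le this.1.2 this.2.2⟩
  · exact Set.Ioo_subset_Ioc_self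
  · refine (Finset.sum_congr rfl fun i _ => ?_).trans_lt hlen
    rw [max_sub_min_eq_abs, Real.dist_eq, abs_sub_comm]

theorem ACloc.integral_deriv_eq_sub {f : ℝ → ℝ} (hf : ACloc f) {a b : ℝ} (hab : a ≤ b) :
    ∫ x in a..b, deriv f x = f b - f a :=
  ((hf a b).absolutelyContinuousOnInterval hab).integral_deriv_eq_sub

theorem BoundedVariationOn.summable_abs_sub_of_monotone {f : ℝ → ℝ}
    (hf : BoundedVariationOn f Set.univ) {x : ℤ → ℝ} (hx : Monotone x) :
    Summable fun k : ℤ => |f (x (k + 1)) - f (x k)| := by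
  refine summable_of_sum_le (c := (eVariationOn f Set.univ).toReal)
    (fun _ => abs_nonneg _) fun F => ?_
  obtain ⟨N, hN⟩ : ∃ N : ℕ, ∀ k ∈ F, k.natAbs ≤ N :=
    ⟨F.sup Int.natAbs, fun k hk => Finset.le_sup (f := Int.natAbs) hk⟩
  have hsub : F ⊆ (Finset.range (2 * N + 1)).image fun i : ℕ => (i : ℤ) - N := by
    intro k hk
    have := hN k hk
    exact Finset.mem_image.2 ⟨(k + N).toNat, by rw [Finset.mem_range]; omega, by omega⟩
  have hinj : Set.InjOn (fun i : ℕ => (i : ℤ) - N) (Finset.range (2 * N + 1)) := by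
    intro i _ j _ h
    simpa using h
  have hmono : Monotone fun i : ℕ => x ((i : ℤ) - N) :=
    fun i j hij => hx (by simpa using hij)
  have hvar := eVariationOn.sum_le (f := f) (n := 2 * N + 1) hmono fun i => Set.mem_univ _
  calc ∑ k ∈ F, |f (x (k + 1)) - f (x k)|
      ≤ ∑ k ∈ (Finset.range (2 * N + 1)).image fun i : ℕ => (i : ℤ) - N,
          |f (x (k + 1)) - f (x k)| :=
        Finset.sum_le_sum_of_subset_of_nonneg hsub fun _ _ _ => abs_nonneg _
    _ = ∑ i ∈ Finset.range (2 * N + 1), |f (x ((i : ℤ) - N + 1)) - f (x ((i : ℤ) - N))| :=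
        Finset.sum_image hinj
    _ ≤ (eVariationOn f Set.univ).toReal := by
        rw [← ENNReal.ofReal_le_iff_le_toReal hf,
          ENNReal.ofReal_sum_of_nonneg fun _ _ => abs_nonneg _]
        refine le_of_eq_of_le (Finset.sum_congr rfl fun i _ => ?_) hvar
        rw [edist_dist, Real.dist_eq]
        push_cast
        rw [sub_add_eq_add_sub]

theorem summable_abs_integral_translates {χ : ℝ → ℝ} (hcont : Continuous χ) {A : ℝ}
    (habs : ∀ u : ℝ, Summable fun k : ℤ => |χ (u - k)|)
    (hA : ∀ u : ℝ, ∑' k : ℤ, |χ (u - k)| ≤ A) (a b : ℝ) :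
    Summable fun k : ℤ => |∫ u in a..b, χ (u - k)| := by
  wlog hab : a ≤ b generalizing a b
  · simpa only [intervalIntegral.integral_symm a b, abs_neg] using this b a (le_of_not_ge hab)
  have hint (k : ℤ) : IntervalIntegrable (fun u => |χ (u - k)|) volume a b :=
    Continuous.intervalIntegrable (by fun_prop) a b
  refine summable_of_sum_le (c := (b - a) * A) (fun _ => abs_nonneg _) fun F => ?_
  calc ∑ k ∈ F, |∫ u in a..b, χ (u - k)|
      ≤ ∑ k ∈ F, ∫ u in a..b, |χ (u - k)| :=
        Finset.sum_le_sum fun k _ => intervalIntegral.abs_integral_le_integral_abs hab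
    _ = ∫ u in a..b, ∑ k ∈ F, |χ (u - k)| :=
        (intervalIntegral.integral_finsetSum fun k _ => hint k).symm
    _ ≤ ∫ _ in a..b, A :=
        intervalIntegral.integral_mono_on hab
          (Continuous.intervalIntegrable (by fun_prop) a b) intervalIntegrable_const
          fun u _ => ((habs u).sum_le_tsum F fun _ _ => abs_nonneg _).trans (hA u)
    _ = (b - a) * A := by simp

theorem avgKernel_one_sub (χ : ℝ → ℝ) (y : ℝ) (k : ℤ) :
    avgKernel χ 1 (y - k) = ∫ u in (y - 1 / 2)..(y + 1 / 2), χ (u - k) := by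
  have h := intervalIntegral.integral_comp_add_left (a := -(1 / 2)) (b := 1 / 2)
    (fun u => χ (u - k)) y
  simp only [avgKernel, Nat.cast_one, div_one, one_mul]
  rw [← sub_eq_add_neg] at h
  rw [← h]
  exact intervalIntegral.integral_congr fun v _ => by rw [sub_add_eq_add_sub]

theorem integral_translate_succ (χ : ℝ → ℝ) (a b : ℝ) (k : ℤ) :
    ∫ u in (a + 1 / 2)..(b + 1 / 2), χ (u - ((k + 1 : ℤ) : ℝ)) =
      ∫ u in (a - 1 / 2)..(b - 1 / 2), χ (u - k) := by
  have h := intervalIntegral.integral_comp_add_right (a := a - 1 / 2) (b := b - 1 / 2)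
    (fun u => χ (u - ((k + 1 : ℤ) : ℝ))) 1
  rw [show a - 1 / 2 + 1 = a + 1 / 2 by ring, show b - 1 / 2 + 1 = b + 1 / 2 by ring] at h
  rw [← h]
  refine intervalIntegral.integral_congr fun u _ => ?_
  congr 1
  push_cast
  ring

theorem avgKernel_one_sub_sub_avgKernel {χ : ℝ → ℝ} (hcont : Continuous χ) (y y₀ : ℝ) (k : ℤ) :
    avgKernel χ 1 (y - k) - avgKernel χ 1 (y₀ - k) =
      (∫ u in (y₀ + 1 / 2)..(y + 1 / 2), χ (u - k)) -
        ∫ u in (y₀ - 1 / 2)..(y - 1 / 2), χ (u - k) := by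
  have hint (a b : ℝ) : IntervalIntegrable (fun u => χ (u - k)) volume a b :=
    Continuous.intervalIntegrable (by fun_prop) a b
  rw [avgKernel_one_sub, avgKernel_one_sub,
    intervalIntegral.integral_interval_sub_interval_comm (hint _ _) (hint _ _) (hint _ _),
    intervalIntegral.integral_symm (y₀ - 1 / 2), intervalIntegral.integral_symm (y₀ + 1 / 2)]
  ring

theorem tsum_mul_avgKernel_one_sub_tsum {χ : ℝ → ℝ} (hcont : Continuous χ) {A : ℝ}
    (habs : ∀ u : ℝ, Summable fun k : ℤ => |χ (u - k)|)
    (hA : ∀ u : ℝ, ∑' k : ℤ, |χ (u - k)| ≤ A) {c : ℤ → ℝ} {B : ℝ} (hB : ∀ k, |c k| ≤ B)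
    (y y₀ : ℝ) :
    ∑' k : ℤ, c k * avgKernel χ 1 (y - k) - ∑' k : ℤ, c k * avgKernel χ 1 (y₀ - k) =
      ∑' k : ℤ, (c (k + 1) - c k) * ∫ u in (y₀ - 1 / 2)..(y - 1 / 2), χ (u - k) := by
  have hsum (d : ℤ → ℝ) (hd : ∀ k, |d k| ≤ B) (a b : ℝ) :
      Summable fun k : ℤ => d k * ∫ u in a..b, χ (u - k) :=
    ((summable_abs_integral_translates hcont habs hA a b).mul_left B).of_norm_bounded fun k => by
      rw [Real.norm_eq_abs, abs_mul]
      exact mul_le_mul_of_nonneg_right (hd k) (abs_nonneg _)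
  have havg (z : ℝ) : Summable fun k : ℤ => c k * avgKernel χ 1 (z - k) := by
    simpa only [avgKernel_one_sub] using hsum c hB _ _
  have hup := hsum c hB (y₀ + 1 / 2) (y + 1 / 2)
  have hlow := hsum c hB (y₀ - 1 / 2) (y - 1 / 2)
  have hlow' := hsum (fun k => c (k + 1)) (fun k => hB _) (y₀ - 1 / 2) (y - 1 / 2)
  have hshift : ∑' k : ℤ, c k * ∫ u in (y₀ + 1 / 2)..(y + 1 / 2), χ (u - k) =
      ∑' k : ℤ, c (k + 1) * ∫ u in (y₀ - 1 / 2)..(y - 1 / 2), χ (u - k) := by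
    rw [← (Equiv.addRight (1 : ℤ)).tsum_eq]
    simp only [Equiv.coe_addRight, integral_translate_succ]
  rw [← (havg y).tsum_sub (havg y₀)]
  simp only [← mul_sub, avgKernel_one_sub_sub_avgKernel hcont, sub_mul]
  rw [hlow'.tsum_sub hlow, ← hshift, ← hup.tsum_sub hlow]
  simp only [mul_sub]

theorem kantorovich_deriv_sub {χ f : ℝ → ℝ} (hf : ACloc f) {w : ℝ} (hw : 0 < w) (t : ℝ) :
    kantorovich χ (deriv f) w (t - 1 / (2 * w)) =
      ∑' k : ℤ, (f (((k + 1 : ℤ) : ℝ) / w) - f (k / w)) * (χ (w * t - 1 / 2 - k) * w) := by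
  refine tsum_congr fun k => ?_
  rw [hf.integral_deriv_eq_sub (by gcongr; linarith),
    show w * (t - 1 / (2 * w)) - k = w * t - 1 / 2 - k by field_simp]
  push_cast
  ring

theorem stmt13 (χ f : ℝ → ℝ)
    (hBV : BoundedVariationOn f Set.univ) (hAC : ACloc f)
    (hcont : Continuous χ) (hint : Integrable χ) (A : ℝ)
    (habs : ∀ u : ℝ, Summable fun k : ℤ => |χ (u - k)|)
    (hA : ∀ u : ℝ, ∑' k : ℤ, |χ (u - k)| ≤ A)
    (w : ℝ) (hw : 0 < w) :
    ∀ t : ℝ,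
      HasDerivAt (avgSamplingSeries χ f 1 w)
        (kantorovich χ (deriv f) w (t - 1 / (2 * w))) t := by
  intro t₀
  have hχ (u : ℝ) : |χ u| ≤ A := by
    have h := (habs u).le_tsum 0 fun _ _ => abs_nonneg _
    simpa using h.trans (hA u)
  have hc : Summable fun k : ℤ => |f (((k + 1 : ℤ) : ℝ) / w) - f ((k : ℝ) / w)| :=
    hBV.summable_abs_sub_of_monotone (x := fun k : ℤ => (k : ℝ) / w) fun i j hij => by
      simp only
      gcongr
  have hB (k : ℤ) : |f ((k : ℝ) / w)| ≤ (eVariationOn f Set.univ).toReal + |f 0| := by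
    have h := hBV.dist_le (Set.mem_univ ((k : ℝ) / w)) (Set.mem_univ 0)
    rw [Real.dist_eq] at h
    linarith [abs_sub_abs_le_abs_sub (f ((k : ℝ) / w)) (f 0)]
  have hS : avgSamplingSeries χ f 1 w = fun t => avgSamplingSeries χ f 1 w t₀ +
      ∑' k : ℤ, (f (((k + 1 : ℤ) : ℝ) / w) - f (k / w)) *
        ∫ u in (w * t₀ - 1 / 2)..(w * t - 1 / 2), χ (u - k) := by
    funext t
    exact sub_eq_iff_eq_add'.1
      (tsum_mul_avgKernel_one_sub_tsum hcont habs hA hB (w * t) (w * t₀))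
  rw [hS, kantorovich_deriv_sub hAC hw]
  apply HasDerivAt.const_add
  refine hasDerivAt_tsum (y₀ := t₀)
    (g' := fun (k : ℤ) t => (f (((k + 1 : ℤ) : ℝ) / w) - f (k / w)) * (χ (w * t - 1 / 2 - k) * w))
    (hc.mul_right (A * w)) (fun k t => ?_) (fun k t => ?_) ?_ t₀
  · have hcomp : Continuous fun u => χ (u - k) := by fun_prop
    have hlin : HasDerivAt (fun t => w * t - 1 / 2) w t := by
      simpa using ((hasDerivAt_id t).const_mul w).sub_const (1 / 2)
    have hprim := (hcomp.integral_hasStrictDerivAt (w * t₀ - 1 / 2) (w * t - 1 / 2)).hasDerivAt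
    exact (hprim.comp t hlin).const_mul _
  · rw [Real.norm_eq_abs, abs_mul, abs_mul, abs_of_pos hw]
    gcongr
    exact hχ _
  · simp
end

section
/- (Characterization of absolute continuity) Let f ∈ BV(ℝ) and fix m ∈ ℕ, m ≥ 1. Then V[S̄ᵐ_w f − f] → 0 as w → +∞ if and only if f ∈ AC(ℝ). -/
open MeasureTheory Filter

theorem BoundedVariationOn.exists_monotone_sub {F : ℝ → ℝ}
    (h : BoundedVariationOn F Set.univ) :
    ∃ p q : ℝ → ℝ, Monotone p ∧ Monotone q ∧ F = p - q ∧
      ∀ x y, x ≤ y → (p y - p x) + (q y - q x) ≤ (eVariationOn F Set.univ).toReal := by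
  obtain ⟨p, q, hp, hq, hF, hv⟩ :=
    h.locallyBoundedVariationOn.exists_monotoneOn_sub_monotoneOn'
  refine ⟨p, q, monotoneOn_univ.1 hp, monotoneOn_univ.1 hq, hF, fun x y hxy => ?_⟩
  rw [hv x trivial y trivial, variationOnFromTo, if_pos hxy]
  exact ENNReal.toReal_mono h (eVariationOn.mono F (Set.subset_univ _))

theorem Monotone.sum_sub_le_of_pairwiseDisjoint_Ioo {v : ℝ → ℝ} (hv : Monotone v) {ι : Type*}
    (S : Finset ι) (s t : ι → ℝ) {a b : ℝ} (hab : a ≤ b)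
    (hst : ∀ i ∈ S, a ≤ s i ∧ s i ≤ t i ∧ t i ≤ b)
    (hd : (S : Set ι).PairwiseDisjoint fun i => Set.Ioo (s i) (t i)) :
    ∑ i ∈ S, (v (t i) - v (s i)) ≤ v b - v a := by
  classical
  induction S using Finset.induction_on_max_value s generalizing b with
  | empty => simpa using hv hab
  | insert j S hj hmax ih =>
    have hdS := hd.subset (Finset.coe_subset.2 (Finset.subset_insert j S))
    obtain ⟨haj, hsj, htj⟩ := hst j (Finset.mem_insert_self j S)
    rw [Finset.sum_insert hj]
    rcases hsj.eq_or_lt with hj0 | hj0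
    · have := ih hab (fun i hi => hst i (Finset.mem_insert_of_mem hi)) hdS
      rw [hj0]
      linarith
    · have key : ∀ i ∈ S, a ≤ s i ∧ s i ≤ t i ∧ t i ≤ s j := by
        intro i hi
        obtain ⟨h1, h2, -⟩ := hst i (Finset.mem_insert_of_mem hi)
        refine ⟨h1, h2, ?_⟩
        by_contra! hlt
        have hne : j ≠ i := fun h => hj (h ▸ hi)
        have hdis := hd (Finset.mem_coe.2 (Finset.mem_insert_self j S))
          (Finset.mem_coe.2 (Finset.mem_insert_of_mem hi)) hne
        obtain ⟨z, hz1, hz2⟩ := exists_between (lt_min hj0 hlt)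
        exact Set.disjoint_left.1 hdis ⟨hz1, hz2.trans_le (min_le_left _ _)⟩
          ⟨(hmax i hi).trans_lt hz1, hz2.trans_le (min_le_right _ _)⟩
      have := ih haj key hdS
      have := hv htj
      linarith

theorem ACOn.of_exists_lipschitz_approx {f : ℝ → ℝ}
    (h : ∀ ε > (0 : ℝ), ∃ g : ℝ → ℝ, ∃ L : ℝ, (∀ s t, s ≤ t → |g t - g s| ≤ L * (t - s)) ∧
      eVariationOn (fun t => g t - f t) Set.univ < ENNReal.ofReal ε) (a b : ℝ) :
    ACOn f a b := by
  intro ε hε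
  obtain ⟨g, L, hL, hV⟩ := h (ε / 2) (by positivity)
  have hbv : BoundedVariationOn (fun t => g t - f t) Set.univ := (hV.trans_le le_top).ne
  obtain ⟨p, q, hp, hq, hF, hpq⟩ := hbv.exists_monotone_sub
  have hV' : (eVariationOn (fun t => g t - f t) Set.univ).toReal < ε / 2 := by
    rw [← ENNReal.lt_ofReal_iff_toReal_lt hbv]
    exact hV
  refine ⟨ε / (2 * (|L| + 1)), by positivity, fun n s t hst hd hlen => ?_⟩
  rcases n.eq_zero_or_pos with rfl | hn
  · simpa using hε
  have hab : a ≤ b := (hst 0 hn).1.trans ((hst 0 hn).2.1.trans (hst 0 hn).2.2)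
  have hv := Monotone.sum_sub_le_of_pairwiseDisjoint_Ioo (hp.add hq) (Finset.range n) s t hab
    (fun i hi => hst i (Finset.mem_range.1 hi)) hd
  have hbound : ∀ i ∈ Finset.range n, |f (t i) - f (s i)| ≤
      |L| * (t i - s i) + ((p + q) (t i) - (p + q) (s i)) := by
    intro i hi
    obtain ⟨-, h2, -⟩ := hst i (Finset.mem_range.1 hi)
    have h3 := (hL _ _ h2).trans (mul_le_mul_of_nonneg_right (le_abs_self L) (sub_nonneg.2 h2))
    have h4 := congrFun hF (t i)
    have h5 := congrFun hF (s i)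
    have h6 := hp h2
    have h7 := hq h2
    simp only [Pi.sub_apply] at h4 h5
    rw [abs_le] at h3 ⊢
    simp only [Pi.add_apply]
    constructor <;> linarith
  have hsum := Finset.sum_le_sum hbound
  rw [Finset.sum_add_distrib, ← Finset.mul_sum] at hsum
  have h8 := hpq a b hab
  simp only [Pi.add_apply] at hv hsum
  have h9 : |L| * ∑ i ∈ Finset.range n, (t i - s i) ≤ ε / 2 := by
    calc |L| * ∑ i ∈ Finset.range n, (t i - s i)
        ≤ (|L| + 1) * (ε / (2 * (|L| + 1))) := by
          gcongr
          · exact Finset.sum_nonneg fun i hi => sub_nonneg.2 (hst i (Finset.mem_range.1 hi)).2.1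
          · linarith
      _ = ε / 2 := by field_simp
  linarith

theorem ACloc.absolutelyContinuousOnInterval {f : ℝ → ℝ} (h : ACloc f) (a b : ℝ) :
    AbsolutelyContinuousOnInterval f a b := by
  rw [absolutelyContinuousOnInterval_iff]
  intro ε hε
  obtain ⟨δ, hδ, H⟩ := h (min a b) (max a b) ε hε
  refine ⟨δ, hδ, fun E hE hlen => ?_⟩
  have hdist : ∀ x y : ℝ, dist x y = max x y - min x y := fun x y => by
    rw [Real.dist_eq, max_sub_min_eq_abs, abs_sub_comm]
  have := H E.1 (fun i => min (E.2 i).1 (E.2 i).2) (fun i => max (E.2 i).1 (E.2 i).2) ?_ ?_ ?_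
  · refine lt_of_le_of_lt (Finset.sum_le_sum fun i _ => ?_) this
    rw [Real.dist_eq]
    rcases le_total (E.2 i).1 (E.2 i).2 with hle | hle
    · simp [hle, abs_sub_comm]
    · simp [hle]
  · intro i hi
    obtain ⟨⟨h1, h2⟩, h3, h4⟩ := hE.1 i (Finset.mem_range.2 hi)
    exact ⟨le_min h1 h3, min_le_max, max_le h2 h4⟩
  · intro i hi j hj hij
    exact (hE.2 hi hj hij).mono Set.Ioo_subset_Ioc_self Set.Ioo_subset_Ioc_self
  · simpa only [hdist] using hlen

theorem Monotone.integrable_deriv {p : ℝ → ℝ} (hp : Monotone p) {C : ℝ}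
    (hC : ∀ x y, x ≤ y → p y - p x ≤ C) : Integrable (deriv p) := by
  have hi : ∀ a b, IntervalIntegrable (deriv p) volume a b := fun a b =>
    (hp.monotoneOn _).intervalIntegrable_deriv
  refine integrable_of_intervalIntegral_norm_bounded (l := atTop) (a := fun x : ℝ => -x)
    (b := fun x : ℝ => x) C (fun x => (hi _ _).1) tendsto_neg_atTop_atBot tendsto_id ?_
  filter_upwards [eventually_ge_atTop 0] with x hx
  have hx' : -x ≤ x := by linarith
  have h1 := (hp.monotoneOn (Set.uIcc (-x) x)).intervalIntegral_deriv_mem_uIcc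
  rw [Set.uIcc_of_le (sub_nonneg.2 (hp hx'))] at h1
  calc ∫ y in (-x)..x, ‖deriv p y‖ = ∫ y in (-x)..x, deriv p y := by
        refine intervalIntegral.integral_congr fun y _ => ?_
        exact Real.norm_of_nonneg hp.deriv_nonneg
    _ ≤ p x - p (-x) := h1.2
    _ ≤ C := hC _ _ hx'

theorem BoundedVariationOn.integrable_deriv {f : ℝ → ℝ} (h : BoundedVariationOn f Set.univ) :
    Integrable (deriv f) := by
  obtain ⟨p, q, hp, hq, rfl, hpq⟩ := h.exists_monotone_sub
  have hp' := hp.integrable_deriv (C := (eVariationOn (p - q) Set.univ).toReal)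
    fun x y hxy => by linarith [hpq x y hxy, hq hxy]
  have hq' := hq.integrable_deriv (C := (eVariationOn (p - q) Set.univ).toReal)
    fun x y hxy => by linarith [hpq x y hxy, hp hxy]
  refine (hp'.sub hq').congr ?_
  filter_upwards [hp.ae_differentiableAt, hq.ae_differentiableAt] with x h1 h2
  exact (deriv_sub h1 h2).symm

theorem eVariationOn_le_ofReal_integral_abs {F h : ℝ → ℝ} (hh : Integrable h)
    (hF : ∀ s t, s ≤ t → F t - F s = ∫ u in s..t, h u) :
    eVariationOn F Set.univ ≤ ENNReal.ofReal (∫ u, |h u|) := by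
  refine iSup_le fun ⟨n, u, hu, _⟩ => ?_
  have hi : ∀ a b, IntervalIntegrable (fun x => |h x|) volume a b := fun a b =>
    hh.abs.intervalIntegrable
  calc ∑ i ∈ Finset.range n, edist (F (u (i + 1))) (F (u i))
      ≤ ∑ i ∈ Finset.range n, ENNReal.ofReal (∫ x in (u i)..(u (i + 1)), |h x|) := by
        refine Finset.sum_le_sum fun i _ => ?_
        have hle := hu i.le_succ
        rw [edist_dist, Real.dist_eq, hF _ _ hle]
        exact ENNReal.ofReal_le_ofReal (intervalIntegral.abs_integral_le_integral_abs hle)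
    _ = ENNReal.ofReal (∑ i ∈ Finset.range n, ∫ x in (u i)..(u (i + 1)), |h x|) := by
        rw [ENNReal.ofReal_sum_of_nonneg]
        exact fun i _ => intervalIntegral.integral_nonneg (hu i.le_succ) fun x _ => abs_nonneg _
    _ ≤ ENNReal.ofReal (∫ x, |h x|) := by
        refine ENNReal.ofReal_le_ofReal ?_
        rw [intervalIntegral.sum_integral_adjacent_intervals fun k _ => hi _ _,
          intervalIntegral.integral_of_le (hu (Nat.zero_le n))]
        exact setIntegral_le_integral hh.abs (Eventually.of_forall fun x => abs_nonneg _)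

theorem MeasureTheory.Integrable.tendsto_integral_abs_translate_sub {g : ℝ → ℝ}
    (hg : Integrable g) :
    Tendsto (fun h : ℝ => ∫ u, |g (u + h) - g u|) (nhds 0) (nhds 0) := by
  let G : C(ℝ, C(ℝ, ℝ)) := (ContinuousMap.mk (fun a : ℝ × ℝ => a.2 + a.1) (by fun_prop)).curry
  have hG : ∀ h, MeasurePreserving (G h) volume volume := fun h =>
    measurePreserving_add_right volume h
  have hc : Continuous fun h : ℝ =>
      Lp.compMeasurePreserving (G h) (hG h) (hg.toL1 g) :=
    (continuous_const (y := hg.toL1 g)).compMeasurePreservingLp G.continuous hG ENNReal.one_ne_top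
  have ht := tendsto_iff_dist_tendsto_zero.1 (hc.tendsto 0)
  refine ht.congr fun h => ?_
  rw [L1.dist_eq_integral_dist]
  refine integral_congr_ae ?_
  filter_upwards [Lp.coeFn_compMeasurePreserving (hg.toL1 g) (hG h),
    Lp.coeFn_compMeasurePreserving (hg.toL1 g) (hG 0), hg.coeFn_toL1,
    (hG h).quasiMeasurePreserving.ae hg.coeFn_toL1] with u h1 h2 h3 h4
  have h0 : G 0 u = u := add_zero u
  rw [h1, h2, Real.dist_eq, Function.comp, Function.comp, h4, h0, h3]
  rfl

theorem summable_intervalIntegral_abs_comp_sub_intCast {χ : ℝ → ℝ} (hcont : Continuous χ) {A : ℝ}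
    (habs : ∀ u : ℝ, Summable fun k : ℤ => |χ (u - k)|)
    (hA : ∀ u : ℝ, ∑' k : ℤ, |χ (u - k)| ≤ A) (w c : ℝ) {s t : ℝ} (hst : s ≤ t) :
    Summable fun k : ℤ => ∫ u in s..t, |χ (w * u + c - k)| := by
  have hi : ∀ k : ℤ, IntervalIntegrable (fun u => |χ (w * u + c - k)|) volume s t := fun k =>
    Continuous.intervalIntegrable (by fun_prop) _ _
  refine summable_of_sum_le (c := A * (t - s))
    (fun k => intervalIntegral.integral_nonneg hst fun _ _ => abs_nonneg _) fun S => ?_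
  rw [← intervalIntegral.integral_finsetSum fun k _ => hi k]
  calc ∫ u in s..t, ∑ k ∈ S, |χ (w * u + c - k)| ≤ ∫ _ in s..t, A := by
        refine intervalIntegral.integral_mono_on hst
          (Continuous.intervalIntegrable (by fun_prop) _ _) intervalIntegrable_const fun u _ => ?_
        exact ((habs _).sum_le_tsum S fun _ _ => abs_nonneg _).trans (hA _)
    _ = A * (t - s) := by simp [mul_comm]

theorem avgKernel_comp_sub_avgKernel {χ : ℝ → ℝ} (hcont : Continuous χ) (m : ℕ) (w c s t : ℝ) :
    avgKernel χ m (w * t - c) - avgKernel χ m (w * s - c) =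
      ∫ u in s..t, w / m * (χ (w * u + m / 2 - c) - χ (w * u + -(m / 2) - c)) := by
  have hform : ∀ x, avgKernel χ m x =
      1 / m * ((∫ v in (0 : ℝ)..(x + m / 2), χ v) - ∫ v in (0 : ℝ)..(x + -(m / 2)), χ v) := by
    intro x
    rw [avgKernel, intervalIntegral.integral_comp_add_left,
      intervalIntegral.integral_interval_sub_left (hcont.intervalIntegrable _ _)
        (hcont.intervalIntegrable _ _)]
  have hprim : ∀ x, HasDerivAt (fun y => ∫ v in (0 : ℝ)..y, χ v) (χ x) x := fun x =>
    hcont.integral_hasStrictDerivAt 0 x |>.hasDerivAt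
  have hlin : ∀ d u, HasDerivAt (fun t : ℝ => w * t - c + d) w u := fun d u => by
    simpa using (((hasDerivAt_id u).const_mul w).sub_const c).add_const d
  symm
  refine intervalIntegral.integral_eq_sub_of_hasDerivAt
    (f := fun t => avgKernel χ m (w * t - c)) (fun u _ => ?_)
    (Continuous.intervalIntegrable (by fun_prop) _ _)
  simp only [hform]
  have h1 := (hprim (w * u - c + m / 2)).comp u (hlin _ u)
  have h2 := (hprim (w * u - c + -(m / 2))).comp u (hlin _ u)
  refine ((h1.sub h2).const_mul (1 / (m : ℝ))).congr_deriv ?_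
  rw [show w * u + m / 2 - c = w * u - c + m / 2 by ring,
    show w * u + -(m / 2) - c = w * u - c + -(m / 2) by ring]
  ring

theorem summable_abs_avgKernel_sub_intCast {χ : ℝ → ℝ} (hcont : Continuous χ) {A : ℝ}
    (habs : ∀ u : ℝ, Summable fun k : ℤ => |χ (u - k)|)
    (hA : ∀ u : ℝ, ∑' k : ℤ, |χ (u - k)| ≤ A) (m : ℕ) (x : ℝ) :
    Summable fun k : ℤ => |avgKernel χ m (x - k)| := by
  have hm : -((m : ℝ) / 2) ≤ m / 2 := by linarith [(by positivity : (0 : ℝ) ≤ m / 2)]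
  have h := (summable_intervalIntegral_abs_comp_sub_intCast hcont habs hA 1 x hm).mul_left
    (1 / (m : ℝ))
  refine h.of_nonneg_of_le (fun _ => abs_nonneg _) fun k => ?_
  rw [avgKernel, abs_mul, abs_of_nonneg (by positivity : (0 : ℝ) ≤ 1 / m)]
  refine mul_le_mul_of_nonneg_left ?_ (by positivity)
  refine (intervalIntegral.abs_integral_le_integral_abs hm).trans_eq ?_
  simp only [one_mul]
  congr 1 with v
  congr 2
  ring

theorem Summable.mul_of_abs_le {ι : Type*} {c a : ι → ℝ} {M : ℝ} (hc : ∀ k, |c k| ≤ M)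
    (ha : Summable fun k => |a k|) : Summable fun k => c k * a k := by
  refine Summable.of_norm_bounded (ha.mul_left M) fun k => ?_
  rw [Real.norm_eq_abs, abs_mul]
  exact mul_le_mul_of_nonneg_right (hc k) (abs_nonneg _)

/-- The termwise derivative of `u ↦ ∑ₖ c k * avgKernel χ m (w * u - k)`. -/
noncomputable def avgSeriesDeriv (χ : ℝ → ℝ) (c : ℤ → ℝ) (m : ℕ) (w u : ℝ) : ℝ :=
  ∑' k : ℤ, c k * (w / m * (χ (w * u + m / 2 - k) - χ (w * u + -(m / 2) - k)))

theorem tsum_mul_avgKernel_sub {χ : ℝ → ℝ} (hcont : Continuous χ) {A : ℝ}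
    (habs : ∀ u : ℝ, Summable fun k : ℤ => |χ (u - k)|)
    (hA : ∀ u : ℝ, ∑' k : ℤ, |χ (u - k)| ≤ A) {c : ℤ → ℝ} {M : ℝ} (hc : ∀ k, |c k| ≤ M)
    (m : ℕ) (w : ℝ) {s t : ℝ} (hst : s ≤ t) :
    ∑' k : ℤ, c k * avgKernel χ m (w * t - k) - ∑' k : ℤ, c k * avgKernel χ m (w * s - k) =
      ∫ u in s..t, avgSeriesDeriv χ c m w u := by
  have hS : ∀ x, Summable fun k : ℤ => c k * avgKernel χ m (x - k) := fun x =>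
    .mul_of_abs_le hc (summable_abs_avgKernel_sub_intCast hcont habs hA m x)
  have hM : 0 ≤ M := (abs_nonneg _).trans (hc 0)
  rw [← (hS _).tsum_sub (hS _)]
  simp only [← mul_sub, avgKernel_comp_sub_avgKernel hcont, avgSeriesDeriv,
    ← intervalIntegral.integral_const_mul]
  simp only [intervalIntegral.integral_of_le hst]
  have hcts : ∀ k : ℤ, Continuous fun u =>
      c k * (w / m * (χ (w * u + m / 2 - k) - χ (w * u + -(m / 2) - k))) := fun k => by fun_prop
  refine integral_tsum_of_summable_integral_norm
    (fun k => ((hcts k).intervalIntegrable s t).1) ?_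
  have h1 := summable_intervalIntegral_abs_comp_sub_intCast hcont habs hA w (m / 2) hst
  have h2 := summable_intervalIntegral_abs_comp_sub_intCast hcont habs hA w (-(m / 2)) hst
  refine ((h1.add h2).mul_left (M * |w / m|)).of_nonneg_of_le
    (fun k => integral_nonneg fun _ => norm_nonneg _) fun k => ?_
  rw [← intervalIntegral.integral_of_le hst, ← intervalIntegral.integral_add
    (Continuous.intervalIntegrable (by fun_prop) _ _)
    (Continuous.intervalIntegrable (by fun_prop) _ _), ← intervalIntegral.integral_const_mul]
  refine intervalIntegral.integral_mono_on hst ((hcts k).norm.intervalIntegrable _ _)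
    (Continuous.intervalIntegrable (by fun_prop) _ _) fun u _ => ?_
  rw [Real.norm_eq_abs, abs_mul, abs_mul, mul_assoc]
  gcongr
  · exact hc k
  · exact abs_sub _ _

theorem abs_avgSeriesDeriv_le {χ : ℝ → ℝ} {A : ℝ}
    (habs : ∀ u : ℝ, Summable fun k : ℤ => |χ (u - k)|)
    (hA : ∀ u : ℝ, ∑' k : ℤ, |χ (u - k)| ≤ A) {c : ℤ → ℝ} {M : ℝ} (hc : ∀ k, |c k| ≤ M)
    (m : ℕ) (w u : ℝ) :
    |avgSeriesDeriv χ c m w u| ≤ M * |w / m| * (A + A) := by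
  have hM : 0 ≤ M := (abs_nonneg _).trans (hc 0)
  have h1 := habs (w * u + m / 2)
  have h2 := habs (w * u + -(m / 2))
  have h3 := tsum_of_norm_bounded ((h1.add h2).mul_left (M * |w / m|)).hasSum
    (f := fun k : ℤ => c k * (w / m * (χ (w * u + m / 2 - k) - χ (w * u + -(m / 2) - k)))) ?_
  · refine h3.trans ?_
    rw [tsum_mul_left, h1.tsum_add h2]
    gcongr
    · exact hA _
    · exact hA _
  · intro k
    rw [Real.norm_eq_abs, abs_mul, abs_mul, mul_assoc]
    gcongr
    · exact hc k
    · exact abs_sub _ _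

theorem avgSeriesDeriv_eq_sum_kantorovich {χ f g : ℝ → ℝ}
    (habs : ∀ u : ℝ, Summable fun k : ℤ => |χ (u - k)|) {M : ℝ} (hM : ∀ x, |f x| ≤ M)
    (hfg : ∀ a b, ∫ u in a..b, g u = f b - f a) (m : ℕ) {w : ℝ} (hw : 0 < w) (u : ℝ) :
    avgSeriesDeriv χ (fun k => f (k / w)) m w u =
      1 / m * ∑ i ∈ Finset.range m, kantorovich χ g w (u + (i - m / 2) / w) := by
  have hS : ∀ (x d : ℝ), Summable fun k : ℤ => f ((k + d) / w) * χ (x - k) := fun x d =>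
    .mul_of_abs_le (fun _ => hM _) (habs x)
  have hK : ∀ i : ℕ, kantorovich χ g w (u + (i - m / 2) / w) =
      w * (∑' k : ℤ, f ((k + ((i + 1 : ℕ) : ℝ)) / w) * χ (w * u + -(m / 2) - k) -
        ∑' k : ℤ, f ((k + (i : ℝ)) / w) * χ (w * u + -(m / 2) - k)) := by
    intro i
    rw [← (hS _ _).tsum_sub (hS _ _), ← tsum_mul_left, kantorovich,
      ← (Equiv.addRight (i : ℤ)).tsum_eq]
    refine tsum_congr fun k => ?_
    rw [hfg]
    simp only [Equiv.coe_addRight, Int.cast_add, Int.cast_natCast, Nat.cast_add, Nat.cast_one]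
    rw [show w * (u + ((i : ℝ) - m / 2) / w) - (k + i) = w * u + -(m / 2) - k by
      field_simp; ring, add_assoc]
    ring
  have hshift : ∑' k : ℤ, f ((k + (m : ℝ)) / w) * χ (w * u + -(m / 2) - k) =
      ∑' k : ℤ, f (k / w) * χ (w * u + m / 2 - k) := by
    rw [← (Equiv.addRight (m : ℤ)).tsum_eq (fun k : ℤ => f (k / w) * χ (w * u + m / 2 - k))]
    refine tsum_congr fun k => ?_
    simp only [Equiv.coe_addRight, Int.cast_add, Int.cast_natCast]
    congr 2
    ring
  have h1 : Summable fun k : ℤ => f (k / w) * χ (w * u + m / 2 - k) := by simpa using hS _ 0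
  have h2 : Summable fun k : ℤ => f (k / w) * χ (w * u + -(m / 2) - k) := by simpa using hS _ 0
  simp only [hK, ← Finset.mul_sum]
  rw [Finset.sum_range_sub
    (fun i : ℕ => ∑' k : ℤ, f ((k + (i : ℝ)) / w) * χ (w * u + -(m / 2) - k)), hshift]
  simp only [Nat.cast_zero, add_zero]
  rw [← h1.tsum_sub h2, ← mul_assoc, ← tsum_mul_left, avgSeriesDeriv]
  refine tsum_congr fun k => ?_
  ring

theorem MeasureTheory.integrable_tsum_of_summable_integral_norm {α ι : Type*} [Countable ι]
    [MeasurableSpace α] {μ : Measure α} {F : ι → α → ℝ} (hF : ∀ i, Integrable (F i) μ)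
    (hsum : Summable fun i => ∫ a, ‖F i a‖ ∂μ) : Integrable (fun a => ∑' i, F i a) μ := by
  have hL : Summable fun i => ‖(hF i).toL1 (F i)‖ := by
    simpa only [L1.norm_of_fun_eq_integral_norm] using hsum
  have hL' : ∑' i, ‖(hF i).toL1 (F i)‖ₑ ≠ ⊤ := tsum_enorm_ne_top_iff_summable_norm.2 hL
  refine (L1.integrable_coeFn (∑' i, (hF i).toL1 (F i))).congr ?_
  filter_upwards [Lp.hasSum_coeFn_tsum hL', ae_all_iff.2 fun i => (hF i).coeFn_toL1] with a h1 h2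
  rw [← h1.tsum_eq]
  exact tsum_congr h2

theorem integrable_kantorovich {χ g : ℝ → ℝ} (hint : Integrable χ) (hg : Integrable g) {w : ℝ}
    (hw : 0 < w) : Integrable (kantorovich χ g w) := by
  have hχ : ∀ k : ℤ, Integrable fun t => χ (w * t - k) := fun k =>
    (hint.comp_sub_right (k : ℝ)).comp_mul_left' hw.ne'
  refine integrable_tsum_of_summable_integral_norm (fun k => (hχ k).const_mul _) ?_
  have hmeas : ∀ k : ℤ, MeasurableSet (Set.Ioc (k • w⁻¹) ((k + 1) • w⁻¹)) := fun _ =>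
    measurableSet_Ioc
  have hs := (hasSum_integral_iUnion (μ := volume) (f := fun x => |g x|) hmeas
    (Set.pairwise_disjoint_Ioc_zsmul _) hg.abs.integrableOn).summable
  refine (hs.mul_left (w * (w⁻¹ * ∫ t, |χ t|))).of_nonneg_of_le
    (fun _ => integral_nonneg fun _ => norm_nonneg _) fun k => ?_
  have hk : (k : ℝ) / w ≤ (k + 1) / w := by gcongr; linarith
  have h1 : ∫ t, |χ (w * t - k)| = w⁻¹ * ∫ t, |χ t| := by
    rw [Measure.integral_comp_mul_left (fun t => |χ (t - k)|) w,
      integral_sub_right_eq_self (fun t => |χ t|), abs_of_pos (inv_pos.2 hw), smul_eq_mul]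
  have h2 : |∫ u in ((k : ℝ) / w)..((k + 1) / w), g u| ≤
      ∫ u in Set.Ioc (k • w⁻¹) ((k + 1) • w⁻¹), |g u| := by
    refine (intervalIntegral.abs_integral_le_integral_abs hk).trans_eq ?_
    rw [intervalIntegral.integral_of_le hk]
    simp [div_eq_mul_inv]
  simp only [norm_mul, Real.norm_eq_abs, integral_const_mul, h1, abs_of_pos hw]
  calc w * |∫ u in ((k : ℝ) / w)..((k + 1) / w), g u| * (w⁻¹ * ∫ t, |χ t|)
      ≤ w * (∫ u in Set.Ioc (k • w⁻¹) ((k + 1) • w⁻¹), |g u|) * (w⁻¹ * ∫ t, |χ t|) := by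
        gcongr
    _ = _ := by ring

theorem tendsto_eVariationOn_avgSamplingSeries_sub {χ f g : ℝ → ℝ} (hcont : Continuous χ)
    (hint : Integrable χ) {A : ℝ} (habs : ∀ u : ℝ, Summable fun k : ℤ => |χ (u - k)|)
    (hA : ∀ u : ℝ, ∑' k : ℤ, |χ (u - k)| ≤ A) (hg : Integrable g)
    (hKant : Tendsto (fun w : ℝ => ∫ t, |kantorovich χ g w t - g t|) atTop (nhds 0))
    {M : ℝ} (hM : ∀ x, |f x| ≤ M) (hfg : ∀ a b, ∫ u in a..b, g u = f b - f a)
    {m : ℕ} (hm : 1 ≤ m) :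
    Tendsto (fun w : ℝ =>
        eVariationOn (fun t => avgSamplingSeries χ f m w t - f t) Set.univ) atTop (nhds 0) := by
  have hm0 : (0 : ℝ) < m := by exact_mod_cast hm
  let bound : ℝ → ℝ := fun w => 1 / m * ∑ i ∈ Finset.range m,
    ((∫ t, |kantorovich χ g w t - g t|) + ∫ t, |g (t + ((i : ℝ) - m / 2) / w) - g t|)
  have hbound : Tendsto bound atTop (nhds 0) := by
    have hterm : ∀ i ∈ Finset.range m, Tendsto (fun w : ℝ =>
        (∫ t, |kantorovich χ g w t - g t|) + ∫ t, |g (t + ((i : ℝ) - m / 2) / w) - g t|)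
        atTop (nhds 0) := fun i _ => by
      simpa using hKant.add
        (hg.tendsto_integral_abs_translate_sub.comp (tendsto_const_nhds.div_atTop tendsto_id))
    have hlim := (tendsto_finsetSum _ hterm).const_mul (1 / (m : ℝ))
    rwa [Finset.sum_const_zero, mul_zero] at hlim
  have hbound' : Tendsto (fun w => ENNReal.ofReal (bound w)) atTop (nhds 0) := by
    simpa using ENNReal.tendsto_ofReal hbound
  refine tendsto_of_tendsto_of_tendsto_of_le_of_le' tendsto_const_nhds hbound'
    (Eventually.of_forall fun _ => zero_le) ?_
  filter_upwards [eventually_gt_atTop 0] with w hw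
  have hK := integrable_kantorovich hint hg hw
  let T : ℕ → ℝ → ℝ := fun i u => kantorovich χ g w (u + ((i : ℝ) - m / 2) / w)
  have hT : ∀ i, Integrable (T i) := fun i => hK.comp_add_right _
  have hD : Integrable (avgSeriesDeriv χ (fun k => f (k / w)) m w) := by
    rw [funext (avgSeriesDeriv_eq_sum_kantorovich habs hM hfg m hw)]
    exact (integrable_finsetSum _ fun i _ => hT i).const_mul _
  refine (eVariationOn_le_ofReal_integral_abs (hD.sub hg) fun s t hst => ?_).trans
    (ENNReal.ofReal_le_ofReal ?_)
  · simp only [Pi.sub_apply]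
    rw [intervalIntegral.integral_sub hD.intervalIntegrable hg.intervalIntegrable, hfg,
      ← tsum_mul_avgKernel_sub hcont habs hA (fun _ => hM _) m w hst]
    simp only [avgSamplingSeries]
    ring
  · have hdiff : ∀ i, Integrable fun u => g (u + ((i : ℕ) - (m : ℝ) / 2) / w) := fun i =>
      hg.comp_add_right _
    have hterm1 : ∀ i, Integrable fun u => |T i u - g (u + ((i : ℕ) - (m : ℝ) / 2) / w)| :=
      fun i => ((hT i).sub (hdiff i)).abs
    have hterm2 : ∀ i, Integrable fun u => |g (u + ((i : ℕ) - (m : ℝ) / 2) / w) - g u| :=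
      fun i => ((hdiff i).sub hg).abs
    have hptw : ∀ u, |avgSeriesDeriv χ (fun k => f (k / w)) m w u - g u| ≤
        1 / m * ∑ i ∈ Finset.range m, (|T i u - g (u + ((i : ℕ) - (m : ℝ) / 2) / w)| +
          |g (u + ((i : ℕ) - (m : ℝ) / 2) / w) - g u|) := by
      intro u
      have hsplit : avgSeriesDeriv χ (fun k => f (k / w)) m w u - g u =
          1 / m * ∑ i ∈ Finset.range m, (T i u - g u) := by
        rw [avgSeriesDeriv_eq_sum_kantorovich habs hM hfg m hw, Finset.sum_sub_distrib]
        simp only [Finset.sum_const, Finset.card_range, nsmul_eq_mul, T]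
        rw [mul_sub, ← mul_assoc, one_div_mul_cancel hm0.ne', one_mul]
      rw [hsplit, abs_mul, abs_of_nonneg (by positivity : (0 : ℝ) ≤ 1 / m)]
      gcongr
      exact (Finset.abs_sum_le_sum_abs _ _).trans
        (Finset.sum_le_sum fun i _ => abs_sub_le _ _ _)
    have hsum : ∀ i ∈ Finset.range m,
        Integrable fun u => |T i u - g (u + ((i : ℕ) - (m : ℝ) / 2) / w)| +
          |g (u + ((i : ℕ) - (m : ℝ) / 2) / w) - g u| := fun i _ => (hterm1 i).add (hterm2 i)
    refine (integral_mono (hD.sub hg).abs ((integrable_finsetSum _ hsum).const_mul _)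
      hptw).trans_eq ?_
    rw [integral_const_mul, integral_finsetSum _ hsum]
    refine congrArg _ (Finset.sum_congr rfl fun i _ => ?_)
    rw [integral_add (hterm1 i) (hterm2 i)]
    congr 1
    exact integral_add_right_eq_self (fun t => |kantorovich χ g w t - g t|) _

theorem ACloc.of_tendsto_eVariationOn_avgSamplingSeries_sub {χ f : ℝ → ℝ} (hcont : Continuous χ)
    {A : ℝ} (habs : ∀ u : ℝ, Summable fun k : ℤ => |χ (u - k)|)
    (hA : ∀ u : ℝ, ∑' k : ℤ, |χ (u - k)| ≤ A) {M : ℝ} (hM : ∀ x, |f x| ≤ M) {m : ℕ}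
    (h : Tendsto (fun w : ℝ =>
      eVariationOn (fun t => avgSamplingSeries χ f m w t - f t) Set.univ) atTop (nhds 0)) :
    ACloc f := by
  intro a b
  refine ACOn.of_exists_lipschitz_approx (fun ε hε => ?_) a b
  obtain ⟨w, hw⟩ := (h.eventually_lt_const (ENNReal.ofReal_pos.2 hε)).exists
  refine ⟨avgSamplingSeries χ f m w, M * |w / m| * (A + A), fun s t hst => ?_, hw⟩
  simp only [avgSamplingSeries]
  rw [tsum_mul_avgKernel_sub hcont habs hA (fun _ => hM _) m w hst,
    ← abs_of_nonneg (sub_nonneg.2 hst), ← Real.norm_eq_abs]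
  exact intervalIntegral.norm_integral_le_of_norm_le_const fun u _ =>
    abs_avgSeriesDeriv_le habs hA (fun _ => hM _) m w u

/-- Characterization of absolute continuity via convergence in variation of the
generalized sampling series with averaged kernel. -/
theorem stmt14 (χ f : ℝ → ℝ)
    (hBV : BoundedVariationOn f Set.univ)
    (hcont : Continuous χ) (hint : Integrable χ) (A : ℝ)
    (habs : ∀ u : ℝ, Summable fun k : ℤ => |χ (u - k)|)
    (hA : ∀ u : ℝ, ∑' k : ℤ, |χ (u - k)| ≤ A)
    (hsum : ∀ u : ℝ, ∑' k : ℤ, χ (u - k) = 1)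
    (hunif : TendstoLocallyUniformly
      (fun (s : Finset ℤ) (u : ℝ) => ∑ k ∈ s, χ (u - k)) (fun _ => (1 : ℝ)) atTop)
    (hKant : ∀ g : ℝ → ℝ, Integrable g →
      Tendsto (fun w : ℝ => ∫ t, |kantorovich χ g w t - g t|) atTop (nhds 0))
    (m : ℕ) (hm : 1 ≤ m) :
    Tendsto (fun w : ℝ =>
        eVariationOn (fun t => avgSamplingSeries χ f m w t - f t) Set.univ)
      atTop (nhds 0) ↔
    (BoundedVariationOn f Set.univ ∧ ACloc f) := by
  obtain ⟨M, hM⟩ : ∃ M, ∀ x, |f x| ≤ M := by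
    refine ⟨|f 0| + (eVariationOn f Set.univ).toReal, fun x => ?_⟩
    have h := hBV.dist_le (Set.mem_univ x) (Set.mem_univ 0)
    rw [Real.dist_eq] at h
    linarith [abs_sub_abs_le_abs_sub (f x) (f 0)]
  refine ⟨fun h => ⟨hBV, .of_tendsto_eVariationOn_avgSamplingSeries_sub hcont habs hA hM h⟩,
    fun ⟨_, hAC⟩ => ?_⟩
  exact tendsto_eVariationOn_avgSamplingSeries_sub hcont hint habs hA hBV.integrable_deriv
    (hKant _ hBV.integrable_deriv) hM
    (fun a b => (hAC.absolutelyContinuousOnInterval a b).integral_deriv_eq_sub) hm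
end
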